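/- arXiv:2007.13099 — 2 statements merged into one kernel-verified Lean document; each statement's English description precedes it below -/
import Mathlib

section
/- Let μ be a probability measure on ℝ with μ((-∞, 0]) = 0 and continuous cumulative distribution function F that is strictly increasing on (0, ∞). Let δ > 0 and λ ∈ (0,1), and let t_a, t_b > 0 satisfy F(t_a) = 1 - λ/2 and F(t_b) = λ/2. Then μ({z : 2 · min(1 - F(δ z), F(δ z)) > λ}) = F(t_a/δ) - F(t_b/δ). (Results 4(b) and 6(b): for the two-sided test with p-value p = 2·min(p*, 1 - p*), where p* = 1 - F(δZ), the upper tail probability Q_δ(λ) equals F((1/δ)·F⁻¹(1 - λ/2)) - F((1/δ)·F⁻¹(λ/2)).) -/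
open MeasureTheory

/-- For a probability measure with continuous distribution function, the mass of an open interval
is the increment of the distribution function. -/
theorem measureReal_Ioo_eq_cdf_sub (μ : Measure ℝ) [IsProbabilityMeasure μ]
    (hc : Continuous (ProbabilityTheory.cdf μ)) {a b : ℝ} (hab : a ≤ b) :
    μ.real (Set.Ioo a b) = ProbabilityTheory.cdf μ b - ProbabilityTheory.cdf μ a := by
  have h := (ProbabilityTheory.cdf μ).measure_Ioo (a := a) (b := b)
  rw [ProbabilityTheory.measure_cdf, hc.continuousWithinAt.leftLim_eq] at h
  rw [measureReal_def, h, ENNReal.toReal_ofReal]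
  exact sub_nonneg.2 (ProbabilityTheory.monotone_cdf μ hab)

/-- Results 4(b) and 6(b): for the two-sided test with p-value `p = 2·min(1 - F(δZ), F(δZ))`,
where `μ` is the null distribution of a positive test statistic with continuous CDF `F`
strictly increasing on `(0,∞)` and `δ > 0` is the effect size, the upper tail probability at
level `λ ∈ (0,1)` equals `F(t_a/δ) - F(t_b/δ)`, where `F(t_a) = 1 - λ/2` and `F(t_b) = λ/2`. -/
theorem tail_prob_nonnull_pvalue_two_sided
    (μ : Measure ℝ) [IsProbabilityMeasure μ] (hpos : μ (Set.Iic (0 : ℝ)) = 0)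
    (F : ℝ → ℝ) (hF : ∀ x, F x = (μ (Set.Iic x)).toReal)
    (hFc : Continuous F) (hFmono : StrictMonoOn F (Set.Ioi (0 : ℝ)))
    (δ l ta tb : ℝ) (hδ : 0 < δ) (hl : l ∈ Set.Ioo (0 : ℝ) 1)
    (hta : 0 < ta) (htb : 0 < tb)
    (hFta : F ta = 1 - l / 2) (hFtb : F tb = l / 2) :
    (μ {z : ℝ | 2 * min (1 - F (δ * z)) (F (δ * z)) > l}).toReal
      = F (ta / δ) - F (tb / δ) := by
  have hcdf : F = ProbabilityTheory.cdf μ := by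
    ext x
    rw [hF, ProbabilityTheory.cdf_eq_real, measureReal_def]
  have hmono : Monotone F := hcdf ▸ ProbabilityTheory.monotone_cdf μ
  have hlt : tb < ta := hmono.reflect_lt (by linarith [hl.2])
  have hset : {z : ℝ | 2 * min (1 - F (δ * z)) (F (δ * z)) > l} =
      Set.Ioo (tb / δ) (ta / δ) := by
    ext z
    rw [Set.mem_ofPred_eq, Set.mem_Ioo, div_lt_iff₀' hδ, lt_div_iff₀' hδ]
    constructor
    · intro h
      have h₁ := min_le_left (1 - F (δ * z)) (F (δ * z))
      have h₂ := min_le_right (1 - F (δ * z)) (F (δ * z))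
      exact ⟨hmono.reflect_lt (by linarith), hmono.reflect_lt (by linarith)⟩
    · rintro ⟨h₁, h₂⟩
      have hz : 0 < δ * z := htb.trans h₁
      have h₃ := hFmono htb hz h₁
      have h₄ := hFmono hz hta h₂
      have : l / 2 < min (1 - F (δ * z)) (F (δ * z)) :=
        lt_min (by linarith) (by linarith)
      linarith
  rw [hset, hcdf]
  exact measureReal_Ioo_eq_cdf_sub μ (hcdf ▸ hFc) (by gcongr)
end

section
/- Let μ be a probability measure on ℝ with μ((-∞, 0]) = 0 and continuous cumulative distribution function F that is strictly increasing on (0, ∞). Let δ > 0 and let m > 0 be the median of μ, i.e., F(m) = 1/2. Then ∫ 2 · min(1 - F(δ z), F(δ z)) dμ(z) = 2 ∫_{(m,∞)} F(x/δ) dμ(x) - 2 ∫_{(0,m)} F(x/δ) dμ(x). (Results 4(c) and 6(c): the expected non-null p-value of the two-sided test equals the difference of the conditional expectations of F(X/δ) given X above and below the null median.) -/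
open MeasureTheory

/-- Fubini for the region `{(x, z) | δ z ≤ x}`. -/
lemma integral_real_Ici_mul_eq_integral_real_Iic_div (ν μ : Measure ℝ) [IsFiniteMeasure ν]
    [IsFiniteMeasure μ] {δ : ℝ} (hδ : 0 < δ) :
    Integrable (fun z => ν.real (Set.Ici (δ * z))) μ ∧
      ∫ z, ν.real (Set.Ici (δ * z)) ∂μ = ∫ x, μ.real (Set.Iic (x / δ)) ∂ν := by
  have hS : MeasurableSet {p : ℝ × ℝ | δ * p.2 ≤ p.1} :=
    measurableSet_le (by fun_prop) (by fun_prop)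
  have h₁ : ∀ z, (fun x => (x, z)) ⁻¹' {p : ℝ × ℝ | δ * p.2 ≤ p.1} = Set.Ici (δ * z) :=
    fun z => rfl
  have h₂ : ∀ x, Prod.mk x ⁻¹' {p : ℝ × ℝ | δ * p.2 ≤ p.1} = Set.Iic (x / δ) := by
    intro x
    ext z
    simp [le_div_iff₀' hδ]
  have hm₁ : Measurable fun z => ν (Set.Ici (δ * z)) := by
    simpa only [h₁] using measurable_measure_prodMk_right (μ := ν) hS
  have hm₂ : Measurable fun x => μ (Set.Iic (x / δ)) := by
    simpa only [h₂] using measurable_measure_prodMk_left (ν := μ) hS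
  have hl : ∫⁻ z, ν (Set.Ici (δ * z)) ∂μ = ∫⁻ x, μ (Set.Iic (x / δ)) ∂ν := by
    have h₃ := Measure.prod_apply (μ := ν) (ν := μ) hS
    rw [Measure.prod_apply_symm hS] at h₃
    simpa only [h₁, h₂] using h₃
  constructor
  · refine Integrable.of_bound (C := ν.real Set.univ) hm₁.ennreal_toReal.aestronglyMeasurable ?_
    filter_upwards with z
    rw [Real.norm_of_nonneg measureReal_nonneg]
    exact measureReal_mono (Set.subset_univ _)
  · simp only [measureReal_def]
    rw [integral_toReal hm₁.aemeasurable (by simp [measure_lt_top]),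
      integral_toReal hm₂.aemeasurable (by simp [measure_lt_top]), hl]

lemma nullSingletonClass_of_continuous_cdf (μ : Measure ℝ) [IsProbabilityMeasure μ]
    (h : Continuous (ProbabilityTheory.cdf μ)) : NullSingletonClass μ := by
  refine ⟨fun x => ?_⟩
  rw [← ProbabilityTheory.measure_cdf μ, StieltjesFunction.measure_singleton,
    h.continuousAt.continuousWithinAt.leftLim_eq, sub_self, ENNReal.ofReal_zero]

/-- For a positive variable with an atomless law and median `m`, the smaller of the two tail
probabilities at `y` is a difference of upper tails of the law restricted above and below `m`. -/
lemma min_tails_eq_restrict_sub (μ : Measure ℝ) [IsProbabilityMeasure μ] [NullSingletonClass μ]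
    (hpos : μ (Set.Iic (0 : ℝ)) = 0) {m : ℝ} (hmed : μ.real (Set.Iic m) = 1 / 2) (y : ℝ) :
    min (1 - μ.real (Set.Iic y)) (μ.real (Set.Iic y))
      = (μ.restrict (Set.Ioi m)).real (Set.Ici y)
        - (μ.restrict (Set.Ioo 0 m)).real (Set.Ici y) := by
  have hIoi : ∀ a, μ.real (Set.Ioi a) = 1 - μ.real (Set.Iic a) := fun a => by
    rw [← Set.compl_Iic, probReal_compl_eq_one_sub measurableSet_Iic]
  rw [measureReal_restrict_apply measurableSet_Ici, measureReal_restrict_apply measurableSet_Ici]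
  have hmono : Monotone fun a => μ.real (Set.Iic a) := fun a b hab =>
    measureReal_mono (Set.Iic_subset_Iic.2 hab)
  rcases le_or_gt y m with hy | hy
  · have hFy : μ.real (Set.Iic y) ≤ 1 / 2 := hmed ▸ hmono hy
    have h₁ : Set.Ici y ∩ Set.Ioi m = Set.Ioi m :=
      Set.inter_eq_right.2 fun x hx => hy.trans (le_of_lt hx)
    have h₂ : μ.real (Set.Ici y ∩ Set.Ioo 0 m) = μ.real (Set.Ioc y m) := by
      refine measureReal_congr ?_
      have h0 : ∀ᵐ x ∂μ, 0 < x := by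
        rw [ae_iff]
        simpa [Set.Iic] using hpos
      filter_upwards [h0, Measure.ae_ne μ y, Measure.ae_ne μ m] with x hx hxy hxm
      refine propext ⟨fun h => ⟨lt_of_le_of_ne h.1 hxy.symm, h.2.2.le⟩,
        fun h => ⟨h.1.le, hx, lt_of_le_of_ne h.2 hxm⟩⟩
    have h₃ : μ.real (Set.Ioc y m) = μ.real (Set.Iic m) - μ.real (Set.Iic y) := by
      rw [← Set.Ioi_inter_Iic, Set.inter_comm, ← Set.compl_Iic, ← Set.sdiff_eq,
        measureReal_sdiff (Set.Iic_subset_Iic.2 hy) measurableSet_Iic]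
    rw [h₁, h₂, h₃, hIoi, hmed, min_eq_right (by linarith)]
    ring
  · have hFy : 1 / 2 ≤ μ.real (Set.Iic y) := hmed ▸ hmono hy.le
    have h₁ : Set.Ici y ∩ Set.Ioi m = Set.Ici y :=
      Set.inter_eq_left.2 fun x hx => hy.trans_le hx
    have h₂ : Set.Ici y ∩ Set.Ioo 0 m = ∅ :=
      Set.eq_empty_of_forall_notMem fun x hx => absurd (hx.1.trans_lt hx.2.2) hy.not_gt
    rw [h₁, h₂, measureReal_empty, sub_zero, measureReal_congr Ioi_ae_eq_Ici.symm, hIoi,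
      min_eq_left (by linarith)]

/-- Results 4(c) and 6(c): for the two-sided test with p-value `p = 2·min(1 - F(δZ), F(δZ))`,
where `μ` is the null distribution of a positive test statistic with continuous CDF `F`
strictly increasing on `(0,∞)`, `δ > 0` is the effect size and `m > 0` is the null median
(`F(m) = 1/2`), the expected non-null p-value equals
`2∫_{(m,∞)} F(x/δ) dμ - 2∫_{(0,m)} F(x/δ) dμ`. -/
theorem expected_nonnull_pvalue_two_sided
    (μ : Measure ℝ) [IsProbabilityMeasure μ] (hpos : μ (Set.Iic (0 : ℝ)) = 0)
    (F : ℝ → ℝ) (hF : ∀ x, F x = (μ (Set.Iic x)).toReal)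
    (hFc : Continuous F) (hFmono : StrictMonoOn F (Set.Ioi (0 : ℝ)))
    (δ m : ℝ) (hδ : 0 < δ) (hm : 0 < m) (hmed : F m = 1 / 2) :
    ∫ z, 2 * min (1 - F (δ * z)) (F (δ * z)) ∂μ
      = 2 * (∫ x in Set.Ioi m, F (x / δ) ∂μ) - 2 * (∫ x in Set.Ioo 0 m, F (x / δ) ∂μ) := by
  have hFr : F = fun x => μ.real (Set.Iic x) := funext hF
  subst hFr
  have : NullSingletonClass μ := nullSingletonClass_of_continuous_cdf μ
    (by simpa only [← ProbabilityTheory.cdf_eq_real] using hFc)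
  obtain ⟨hi₁, he₁⟩ :=
    integral_real_Ici_mul_eq_integral_real_Iic_div (μ.restrict (Set.Ioi m)) μ hδ
  obtain ⟨hi₂, he₂⟩ :=
    integral_real_Ici_mul_eq_integral_real_Iic_div (μ.restrict (Set.Ioo 0 m)) μ hδ
  simp only [min_tails_eq_restrict_sub μ hpos hmed]
  rw [integral_const_mul, integral_sub hi₁ hi₂, he₁, he₂, mul_sub]
end
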